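/- Let 𝒫 be a prediction set with respect to a measure space (Ω, 𝒜, μ). A scoring rule S : 𝒫⁺ → ℒ(𝒫) is strictly proper if and only if there exists a strictly sublinear function Φ : 𝒫⁺ → ℝ such that S is a strict subgradient of Φ on 𝒫⁺. -/

import Mathlib

set_option linter.unusedSectionVars false
open MeasureTheory Set Filter Topology

variable {Ω : Type*} [MeasurableSpace Ω]

/-- `P` is a prediction set with respect to `μ`: a convex set of probability
densities on `Ω`. -/
def IsPredictionSet (μ : Measure Ω) (P : Set (Ω → ℝ)) : Prop :=
  Convex ℝ P ∧ ∀ p ∈ P, Measurable p ∧ (∀ x, 0 ≤ p x) ∧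
    Integrable p μ ∧ ∫ x, p x ∂μ = 1

/-- The prediction cone `𝒫⁺ = {λ p : λ > 0, p ∈ 𝒫}`. -/
def predCone (P : Set (Ω → ℝ)) : Set (Ω → ℝ) :=
  {f | ∃ c : ℝ, 0 < c ∧ ∃ p ∈ P, f = c • p}

/-- `ℒ(𝒫)`: the `𝒫`-integrable functions. -/
def PIntegrable (μ : Measure Ω) (P : Set (Ω → ℝ)) (f : Ω → ℝ) : Prop :=
  Measurable f ∧ ∀ p ∈ P, Integrable (fun x => |f x| * p x) μ

/-- The pairing `p · f = ∫ f p dμ`. -/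
noncomputable def pairing (μ : Measure Ω) (p f : Ω → ℝ) : ℝ :=
  ∫ x, f x * p x ∂μ

/-- `Φ` is (positively) 1-homogeneous and subadditive on the cone `cone`. -/
def SublinearOn (cone : Set (Ω → ℝ)) (Φ : (Ω → ℝ) → ℝ) : Prop :=
  (∀ p ∈ cone, ∀ c : ℝ, 0 < c → Φ (c • p) = c * Φ p) ∧
  ∀ f ∈ cone, ∀ g ∈ cone, Φ (f + g) ≤ Φ f + Φ g

/-- `p` and `q` are positively collinear. -/
def PosCollinear (p q : Ω → ℝ) : Prop := ∃ c : ℝ, 0 < c ∧ p = c • q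

/-- `𝒟(q)`: the set of directions from `q` into `𝒫⁺`. -/
def dirSet (P : Set (Ω → ℝ)) (q : Ω → ℝ) : Set (Ω → ℝ) :=
  {p | p ∈ Submodule.span ℝ P ∧ ∃ ε : ℝ, 0 < ε ∧ q + ε • p ∈ predCone P}

/-- `𝒪(q) = 𝒟(q) ∩ (−𝒟(q))`. -/
def oSet (P : Set (Ω → ℝ)) (q : Ω → ℝ) : Set (Ω → ℝ) :=
  {p | p ∈ dirSet P q ∧ -p ∈ dirSet P q}

/-- The right directional derivative `Φ′₊(p,q)` of a sublinear `Φ` at `q` along `p`,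
taken in `ℝ ∪ {−∞}` (for sublinear `Φ` the limit of slopes as `t → 0⁺` exists and
equals the infimum of the slopes, which is how it is expressed here). -/
noncomputable def rderiv (P : Set (Ω → ℝ)) (Φ : (Ω → ℝ) → ℝ) (q p : Ω → ℝ) : EReal :=
  ⨅ t : {t : ℝ // 0 < t ∧ q + t • p ∈ predCone P},
    (((Φ (q + (t : ℝ) • p) - Φ q) / (t : ℝ) : ℝ) : EReal)

lemma predCone_subset_span (P : Set (Ω → ℝ)) :
    predCone P ⊆ (Submodule.span ℝ P : Set (Ω → ℝ)) := by
  rintro f ⟨c, hc, p, hp, rfl⟩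
  exact Submodule.smul_mem _ _ (Submodule.subset_span hp)

lemma PosCollinear.symm {p q : Ω → ℝ} (h : PosCollinear p q) : PosCollinear q p := by
  obtain ⟨c, hc, rfl⟩ := h
  exact ⟨c⁻¹, inv_pos.2 hc, by rw [smul_smul, inv_mul_cancel₀ hc.ne', one_smul]⟩

lemma add_mem_predCone {P : Set (Ω → ℝ)} (hP : Convex ℝ P) {f g : Ω → ℝ}
    (hf : f ∈ predCone P) (hg : g ∈ predCone P) : f + g ∈ predCone P := by
  obtain ⟨a, ha, p, hp, rfl⟩ := hf
  obtain ⟨b, hb, q, hq, rfl⟩ := hg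
  have hab : 0 < a + b := add_pos ha hb
  refine ⟨a + b, hab, (a / (a + b)) • p + (b / (a + b)) • q,
    hP hp hq (by positivity) (by positivity) (by field_simp), ?_⟩
  rw [smul_add, smul_smul, smul_smul, mul_div_cancel₀ _ hab.ne', mul_div_cancel₀ _ hab.ne']

lemma integral_pos_of_mem_predCone {μ : Measure Ω} {P : Set (Ω → ℝ)}
    (hP : IsPredictionSet μ P) {f : Ω → ℝ} (hf : f ∈ predCone P) : 0 < ∫ x, f x ∂μ := by
  obtain ⟨a, ha, p, hp, rfl⟩ := hf
  simpa [integral_const_mul, (hP.2 p hp).2.2.2] using ha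

lemma PIntegrable.integrable_mul {μ : Measure Ω} {P : Set (Ω → ℝ)}
    (hP : IsPredictionSet μ P) {s f : Ω → ℝ} (hs : PIntegrable μ P s) (hf : f ∈ predCone P) :
    Integrable (fun x => s x * f x) μ := by
  obtain ⟨a, -, p, hp, rfl⟩ := hf
  obtain ⟨hpm, hp0, -, -⟩ := hP.2 p hp
  have h : Integrable (fun x => s x * p x) μ :=
    (hs.2 p hp).mono (hs.1.mul hpm).aestronglyMeasurable (by simp)
  simpa [mul_left_comm] using h.const_mul a

lemma pairing_smul (μ : Measure Ω) (c : ℝ) (p f : Ω → ℝ) :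
    pairing μ (c • p) f = c * pairing μ p f := by
  simp [pairing, mul_left_comm, integral_const_mul]

lemma pairing_add {μ : Measure Ω} {P : Set (Ω → ℝ)} (hP : IsPredictionSet μ P)
    {s f g : Ω → ℝ} (hs : PIntegrable μ P s) (hf : f ∈ predCone P) (hg : g ∈ predCone P) :
    pairing μ (f + g) s = pairing μ f s + pairing μ g s := by
  simp only [pairing, Pi.add_apply, mul_add]
  exact integral_add (hs.integrable_mul hP hf) (hs.integrable_mul hP hg)

/-- If `f + g` is positively collinear with `f`, comparing integrals shows that the
factor exceeds one. -/
lemma PosCollinear.of_add_left {μ : Measure Ω} {P : Set (Ω → ℝ)} (hP : IsPredictionSet μ P)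
    {f g : Ω → ℝ} (hf : f ∈ predCone P) (hg : g ∈ predCone P)
    (h : PosCollinear (f + g) f) : PosCollinear f g := by
  obtain ⟨c, -, h⟩ := h
  have hgf : g = (c - 1) • f := by rw [sub_smul, one_smul, ← h, add_sub_cancel_left]
  have hint : ∫ x, g x ∂μ = (c - 1) * ∫ x, f x ∂μ := by
    rw [hgf, ← integral_const_mul]; rfl
  have hc : 0 < c - 1 := pos_of_mul_pos_left
    (hint ▸ integral_pos_of_mem_predCone hP hg) (integral_pos_of_mem_predCone hP hf).le
  exact PosCollinear.symm ⟨c - 1, hc, hgf⟩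

/-- A scoring rule `S : 𝒫⁺ → ℒ(𝒫)` is strictly proper iff there is
a strictly sublinear `Φ : 𝒫⁺ → ℝ` such that `S` is a strict subgradient of `Φ` on `𝒫⁺`. -/
theorem strictly_proper_iff_strict_subgradient_of_strictly_sublinear
    (μ : Measure Ω) (P : Set (Ω → ℝ)) (hP : IsPredictionSet μ P)
    (S : (Ω → ℝ) → Ω → ℝ)
    (hSint : ∀ q ∈ predCone P, PIntegrable μ P (S q))
    (hShom : ∀ q ∈ predCone P, ∀ c : ℝ, 0 < c → S (c • q) = S q) :
    (∀ p ∈ predCone P, ∀ q ∈ predCone P, pairing μ p (S q) ≤ pairing μ p (S p) ∧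
        (¬ PosCollinear q p → pairing μ p (S q) < pairing μ p (S p))) ↔
    ∃ Φ : (Ω → ℝ) → ℝ,
      (SublinearOn (predCone P) Φ ∧
        ∀ f ∈ predCone P, ∀ g ∈ predCone P, ¬ PosCollinear f g →
          Φ (f + g) < Φ f + Φ g) ∧
      ∀ q ∈ predCone P,
        (∀ p ∈ predCone P, pairing μ p (S q) ≤ Φ p) ∧
        pairing μ q (S q) = Φ q ∧
        ∀ p ∈ predCone P, ¬ PosCollinear p q → pairing μ p (S q) < Φ p := by
  constructor
  · intro h
    refine ⟨fun p => pairing μ p (S p), ⟨⟨?_, ?_⟩, ?_⟩, fun q hq => ⟨?_, rfl, ?_⟩⟩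
    · intro p hp c hc
      simp only [hShom p hp c hc, pairing_smul]
    · intro f hf g hg
      have hfg := add_mem_predCone hP.1 hf hg
      simp only [pairing_add hP (hSint _ hfg) hf hg]
      exact add_le_add (h f hf _ hfg).1 (h g hg _ hfg).1
    · intro f hf g hg hn
      have hfg := add_mem_predCone hP.1 hf hg
      simp only [pairing_add hP (hSint _ hfg) hf hg]
      exact add_lt_add_of_lt_of_le
        ((h f hf _ hfg).2 fun hc => hn (hc.of_add_left hP hf hg)) (h g hg _ hfg).1
    · exact fun p hp => (h p hp q hq).1
    · exact fun p hp hn => (h p hp q hq).2 fun hc => hn hc.symm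
  · rintro ⟨Φ, -, h⟩ p hp q hq
    rw [(h p hp).2.1]
    exact ⟨(h q hq).1 p hp, fun hn => (h q hq).2.2 p hp fun hc => hn hc.symm⟩
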